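/- Let R be a Prüfer v-multiplication domain that is not a field and let J ⊆ I be nonzero ideals of R. The following are equivalent: (1) J is a t-reduction of I; (2) (J R_M)(I R_M) = (I R_M)² for each maximal t-ideal M of R; (3) (J·I)_t = (I²)_t. -/

import Mathlib

open scoped nonZeroDivisors

section

variable {R : Type*} (K : Type*) [CommRing R] [IsDomain R] [Field K]
  [Algebra R K] [IsFractionRing R K]

/-- The `t`-operation on (nonzero) fractional ideals of `R`:
`I_t = ⋃ J_v`, where `J` ranges over the nonzero finitely generated subideals of `I` and
`J_v = (J⁻¹)⁻¹` (realized as a supremum of `R`-submodules of `K`). -/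
noncomputable def tOp (I : FractionalIdeal R⁰ K) : Submodule R K :=
  ⨆ (J : FractionalIdeal R⁰ K) (_ : J ≠ 0) (_ : J ≤ I) (_ : (J : Submodule R K).FG),
    (((J⁻¹)⁻¹ : FractionalIdeal R⁰ K) : Submodule R K)

/-- An integral ideal `M` of `R` is a `t`-ideal if `M_t = M`. -/
def IsTIdeal (M : Ideal R) : Prop :=
  tOp K (M : FractionalIdeal R⁰ K) = ((M : FractionalIdeal R⁰ K) : Submodule R K)

/-- `M` is a maximal `t`-ideal of `R`: maximal among the proper integral `t`-ideals. -/
def IsMaxTIdeal (M : Ideal R) : Prop :=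
  M ≠ ⊤ ∧ IsTIdeal K M ∧ ∀ N : Ideal R, N ≠ ⊤ → IsTIdeal K N → M ≤ N → M = N

/-- The extension `A·R_M` of an `R`-submodule `A` of `K` to the localization `R_M ⊆ K`
(for `M` a prime ideal of `R`): the set of fractions `a/t` with `a ∈ A`, `t ∉ M`. -/
noncomputable def locMul (M : Ideal R) (A : Submodule R K) : Submodule R K :=
  ⨆ (t : R) (_ : t ∉ M), Submodule.span R {(algebraMap R K t)⁻¹} * A

/-- The `w`-operation: `I_w = ⋂ I·R_M`, the intersection taken over all maximal `t`-ideals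
`M` of `R`. -/
noncomputable def wOp (I : FractionalIdeal R⁰ K) : Submodule R K :=
  ⨅ (M : Ideal R) (_ : IsMaxTIdeal K M), locMul K M (I : Submodule R K)

/-- `R` is a Prüfer `v`-multiplication domain: every nonzero finitely generated ideal is
`t`-invertible. -/
def IsPvMD : Prop :=
  ∀ I : Ideal R, I ≠ ⊥ → I.FG →
    tOp K ((I : FractionalIdeal R⁰ K) * (I : FractionalIdeal R⁰ K)⁻¹) = 1

end

section helpers

variable {R : Type*} {K : Type*} [CommRing R] [IsDomain R] [Field K]
  [Algebra R K] [IsFractionRing R K]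

/-- The `v`-closure of an ideal, as a submodule of `K`. -/
def vS (K : Type*) [Field K] [Algebra R K] (F : Ideal R) : Submodule R K where
  carrier := {x | ∀ y : K, (∀ f ∈ F, ∃ r : R, algebraMap R K r = y * algebraMap R K f) →
    ∃ r : R, algebraMap R K r = x * y}
  add_mem' := by
    intro a b ha hb y hy
    obtain ⟨r, hr⟩ := ha y hy
    obtain ⟨s, hs⟩ := hb y hy
    exact ⟨r + s, by rw [map_add, hr, hs]; ring⟩
  zero_mem' := fun y _ => ⟨0, by simp⟩
  smul_mem' := by
    intro c a ha y hy
    obtain ⟨r, hr⟩ := ha y hy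
    exact ⟨c * r, by rw [map_mul, hr, Algebra.smul_def]; ring⟩

omit [IsDomain R] [IsFractionRing R K] in
lemma vS_mono {F G : Ideal R} (h : F ≤ G) : vS K F ≤ vS K G :=
  fun _ hx y hy => hx y fun f hf => hy f (h hf)

omit [IsDomain R] [IsFractionRing R K] in
lemma mem_vS_self {F : Ideal R} {f : R} (h : f ∈ F) : algebraMap R K f ∈ vS K F := by
  intro y hy
  obtain ⟨r, hr⟩ := hy f h
  exact ⟨r, by rw [hr, mul_comm]⟩

omit [IsDomain R] [IsFractionRing R K] in
lemma vS_idem {F G : Ideal R} (h : ∀ f ∈ F, algebraMap R K f ∈ vS K G) : vS K F ≤ vS K G := by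
  intro x hx y hy
  refine hx y fun f hf => ?_
  obtain ⟨r, hr⟩ := h f hf y hy
  exact ⟨r, by rw [hr, mul_comm]⟩

lemma mem_inv_ideal {F : Ideal R} (hF : F ≠ ⊥) {y : K} :
    y ∈ (F : FractionalIdeal R⁰ K)⁻¹ ↔
      ∀ f ∈ F, ∃ r : R, algebraMap R K r = y * algebraMap R K f := by
  rw [FractionalIdeal.mem_inv_iff (FractionalIdeal.coeIdeal_ne_zero.mpr hF)]
  constructor
  · intro h f hf
    have := h _ (FractionalIdeal.mem_coeIdeal_of_mem R⁰ hf)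
    rwa [FractionalIdeal.mem_one_iff] at this
  · intro h z hz
    obtain ⟨f, hf, rfl⟩ := (FractionalIdeal.mem_coeIdeal _).1 hz
    rw [FractionalIdeal.mem_one_iff]
    exact h f hf

lemma inv_inv_eq_vS {F : Ideal R} (hF : F ≠ ⊥) :
    ((((F : FractionalIdeal R⁰ K)⁻¹)⁻¹ : FractionalIdeal R⁰ K) : Submodule R K) = vS K F := by
  have h0 : (F : FractionalIdeal R⁰ K)⁻¹ ≠ 0 := by
    intro h
    have : (1 : K) ∈ (F : FractionalIdeal R⁰ K)⁻¹ :=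
      (mem_inv_ideal hF).2 fun f _ => ⟨f, by simp⟩
    rw [h, FractionalIdeal.mem_zero_iff] at this
    exact one_ne_zero this
  ext x
  rw [FractionalIdeal.mem_coe, FractionalIdeal.mem_inv_iff h0]
  simp only [mem_inv_ideal hF, FractionalIdeal.mem_one_iff]
  rfl

lemma mem_tOp {N : Ideal R} (hN : N ≠ ⊥) {x : K} :
    x ∈ tOp K (N : FractionalIdeal R⁰ K) ↔
      ∃ F : Ideal R, F ≠ ⊥ ∧ F ≤ N ∧ F.FG ∧ x ∈ vS K F := by
  have e : tOp K (N : FractionalIdeal R⁰ K) =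
      ⨆ F : {F : Ideal R // F ≠ ⊥ ∧ F ≤ N ∧ F.FG}, vS K F.1 := by
    apply le_antisymm
    · refine iSup_le fun G => iSup_le fun hG0 => iSup_le fun hGN => iSup_le fun hG => ?_
      obtain ⟨F, rfl⟩ := FractionalIdeal.le_one_iff_exists_coeIdeal.1
        (hGN.trans FractionalIdeal.coeIdeal_le_one)
      have hF0 : F ≠ ⊥ := FractionalIdeal.coeIdeal_ne_zero.mp hG0
      rw [inv_inv_eq_vS hF0]
      exact le_iSup (fun F : {F : Ideal R // F ≠ ⊥ ∧ F ≤ N ∧ F.FG} => vS K F.1)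
        ⟨F, hF0, (FractionalIdeal.coeIdeal_le_coeIdeal K).1 hGN,
          (FractionalIdeal.coeIdeal_fg R⁰ (IsFractionRing.injective R K) F).1 hG⟩
    · refine iSup_le fun ⟨F, hF0, hFN, hF⟩ => ?_
      refine le_trans ?_ (le_iSup_of_le (F : FractionalIdeal R⁰ K) <|
        le_iSup_of_le (FractionalIdeal.coeIdeal_ne_zero.mpr hF0) <|
        le_iSup_of_le ((FractionalIdeal.coeIdeal_le_coeIdeal K).2 hFN) <|
        le_iSup_of_le
          ((FractionalIdeal.coeIdeal_fg R⁰ (IsFractionRing.injective R K) F).2 hF) le_rfl)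
      rw [inv_inv_eq_vS hF0]
  obtain ⟨b, hb, hb0⟩ := Submodule.exists_mem_ne_zero_of_ne_bot hN
  have : Nonempty {F : Ideal R // F ≠ ⊥ ∧ F ≤ N ∧ F.FG} :=
    ⟨Ideal.span {b}, by simpa using hb0, by simpa [Ideal.span_le] using hb,
      Submodule.fg_span_singleton b⟩
  rw [e, Submodule.mem_iSup_of_directed]
  · constructor
    · rintro ⟨⟨F, h1, h2, h3⟩, h⟩
      exact ⟨F, h1, h2, h3, h⟩
    · rintro ⟨F, h1, h2, h3, h⟩
      exact ⟨⟨F, h1, h2, h3⟩, h⟩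
  · rintro ⟨F, h1, h2, h3⟩ ⟨G, g1, g2, g3⟩
    exact ⟨⟨F ⊔ G, fun h => h1 (le_bot_iff.1 (h ▸ le_sup_left)), sup_le h2 g2, Submodule.FG.sup h3 g3⟩,
      vS_mono le_sup_left, vS_mono le_sup_right⟩

lemma mem_tOp_self {N : Ideal R} {a : R} (ha : a ∈ N) :
    algebraMap R K a ∈ tOp K (N : FractionalIdeal R⁰ K) := by
  by_cases h : a = 0
  · rw [h, map_zero]; exact zero_mem _
  have hN : N ≠ ⊥ := by rintro rfl; exact h (by simpa using ha)
  exact (mem_tOp hN).2 ⟨Ideal.span {a}, by simpa using h, by simpa [Ideal.span_le] using ha,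
    Submodule.fg_span_singleton a, mem_vS_self (Ideal.mem_span_singleton_self a)⟩

lemma tOp_le_of {A B : Ideal R} (hA : A ≠ ⊥) (hB : B ≠ ⊥)
    (h : ∀ a ∈ A, algebraMap R K a ∈ tOp K (B : FractionalIdeal R⁰ K)) :
    tOp K (A : FractionalIdeal R⁰ K) ≤ tOp K (B : FractionalIdeal R⁰ K) := by
  have key : ∀ F : Ideal R, F.FG →
      ((∀ f ∈ F, algebraMap R K f ∈ tOp K (B : FractionalIdeal R⁰ K)) →
      ∃ G : Ideal R, G ≠ ⊥ ∧ G ≤ B ∧ G.FG ∧ ∀ f ∈ F, algebraMap R K f ∈ vS K G) := by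
    intro F hF
    refine Submodule.fg_induction (motive := fun (F : Ideal R) _ =>
      ((∀ f ∈ F, algebraMap R K f ∈ tOp K (B : FractionalIdeal R⁰ K)) →
      ∃ G : Ideal R, G ≠ ⊥ ∧ G ≤ B ∧ G.FG ∧ ∀ f ∈ F, algebraMap R K f ∈ vS K G)) ?_ ?_ F hF
    · intro x hx
      obtain ⟨G, h1, h2, h3, h4⟩ := (mem_tOp hB).1 (hx x (Submodule.mem_span_singleton_self x))
      refine ⟨G, h1, h2, h3, fun f hf => ?_⟩
      obtain ⟨c, rfl⟩ := Submodule.mem_span_singleton.1 hf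
      rw [smul_eq_mul, map_mul, ← Algebra.smul_def]
      exact (vS K G).smul_mem c h4
    · intro F1 F2 _ _ i1 i2 hx
      obtain ⟨G, h1, h2, h3, h4⟩ := i1 fun f hf => hx f (Submodule.mem_sup_left hf)
      obtain ⟨G', h1', h2', h3', h4'⟩ := i2 fun f hf => hx f (Submodule.mem_sup_right hf)
      refine ⟨G ⊔ G', fun h => h1 (le_bot_iff.1 (h ▸ le_sup_left)), sup_le h2 h2', Submodule.FG.sup h3 h3',
        fun f hf => ?_⟩
      obtain ⟨a, ha, b, hb, rfl⟩ := Submodule.mem_sup.1 hf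
      rw [map_add]
      exact add_mem (vS_mono le_sup_left (h4 a ha)) (vS_mono le_sup_right (h4' b hb))
  intro x hx
  obtain ⟨F, _, h2, h3, h4⟩ := (mem_tOp hA).1 hx
  obtain ⟨G, g1, g2, g3, g4⟩ := key F h3 fun f hf => h f (h2 hf)
  exact (mem_tOp hB).2 ⟨G, g1, g2, g3, vS_idem g4 h4⟩

lemma tOp_mono {A B : Ideal R} (hA : A ≠ ⊥) (h : A ≤ B) :
    tOp K (A : FractionalIdeal R⁰ K) ≤ tOp K (B : FractionalIdeal R⁰ K) :=
  tOp_le_of hA (fun hB => hA (le_bot_iff.1 (hB ▸ h))) fun _ ha => mem_tOp_self (h ha)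

/-- An element of `tOp` of an integral ideal is integral. -/
lemma exists_of_mem_tOp {N : Ideal R} (hN : N ≠ ⊥) {x : K}
    (hx : x ∈ tOp K (N : FractionalIdeal R⁰ K)) : ∃ r : R, algebraMap R K r = x := by
  obtain ⟨F, _, _, _, h⟩ := (mem_tOp hN).1 hx
  obtain ⟨r, hr⟩ := h 1 fun f _ => ⟨f, by simp⟩
  exact ⟨r, by simpa using hr⟩

/-- The `t`-closure of an ideal. -/
noncomputable def tI (K : Type*) [Field K] [Algebra R K] [IsFractionRing R K] (N : Ideal R) :
    Ideal R := (tOp K (N : FractionalIdeal R⁰ K)).comap (Algebra.linearMap R K)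

lemma mem_tI {N : Ideal R} {a : R} :
    a ∈ tI K N ↔ algebraMap R K a ∈ tOp K (N : FractionalIdeal R⁰ K) := Iff.rfl

lemma le_tI (N : Ideal R) : N ≤ tI K N := fun _ ha => mem_tOp_self ha

lemma isTIdeal_of {N : Ideal R} (hN : N ≠ ⊥) (h : tI K N ≤ N) : IsTIdeal K N := by
  apply le_antisymm
  · intro x hx
    obtain ⟨r, rfl⟩ := exists_of_mem_tOp hN hx
    exact FractionalIdeal.mem_coeIdeal_of_mem R⁰ (h hx)
  · intro x hx
    obtain ⟨r, hr, rfl⟩ := (FractionalIdeal.mem_coeIdeal _).1 hx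
    exact mem_tOp_self hr

lemma isTIdeal_tI {N : Ideal R} (hN : N ≠ ⊥) : IsTIdeal K (tI K N) := by
  have h : tI K N ≠ ⊥ := fun h => hN (le_bot_iff.1 (h ▸ le_tI N))
  exact isTIdeal_of h fun a ha => tOp_le_of h hN (fun _ hb => hb) ha

lemma IsTIdeal.mem {N : Ideal R} (h : IsTIdeal K N) {a : R}
    (ha : algebraMap R K a ∈ tOp K (N : FractionalIdeal R⁰ K)) : a ∈ N := by
  rw [IsTIdeal] at h
  rw [h] at ha
  obtain ⟨b, hb, e⟩ := (FractionalIdeal.mem_coeIdeal _).1 ha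
  exact IsFractionRing.injective R K e ▸ hb

/-- Transport: if `1 ∈ N_t` and `x N ⊆ B` then `x ∈ B_t`. -/
lemma mem_tOp_of_smul {N B : Ideal R} (hN : N ≠ ⊥) (h1 : (1 : K) ∈ tOp K (N : FractionalIdeal R⁰ K))
    {x : K} (h : ∀ a ∈ N, ∃ b ∈ B, algebraMap R K b = algebraMap R K a * x) :
    x ∈ tOp K (B : FractionalIdeal R⁰ K) := by
  by_cases hx : x = 0
  · rw [hx]; exact zero_mem _
  obtain ⟨F, f0, f1, f2, f3⟩ := (mem_tOp hN).1 h1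
  -- the ideal `x F`
  let L : R →ₗ[R] K := (LinearMap.toSpanSingleton R K x)
  have hL : ∀ a, L a = algebraMap R K a * x := fun a => by
    simp [L, LinearMap.toSpanSingleton_apply, Algebra.smul_def]
  let G : Ideal R := Submodule.comap (Algebra.linearMap R K) (Submodule.map L F)
  have hGm : Submodule.map (Algebra.linearMap R K) G = Submodule.map L F := by
    rw [Submodule.map_comap_eq, inf_eq_right]
    rintro _ ⟨a, ha, rfl⟩
    obtain ⟨b, _, hb'⟩ := h a (f1 ha)
    exact ⟨b, by rw [hL, ← hb']; rfl⟩
  have hG : G.FG := by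
    refine Submodule.fg_of_fg_map_injective (Algebra.linearMap R K)
      (IsFractionRing.injective R K) ?_
    rw [hGm]; exact Submodule.FG.map L f2
  have hGB : G ≤ B := by
    rintro g ⟨a, ha, e⟩
    obtain ⟨b, hb, hb'⟩ := h a (f1 ha)
    rw [hL, ← hb'] at e
    exact IsFractionRing.injective R K e ▸ hb
  obtain ⟨a, ha, ha0⟩ := Submodule.exists_mem_ne_zero_of_ne_bot f0
  obtain ⟨b, hb, hb'⟩ := h a (f1 ha)
  have hbG : ∀ a ∈ F, ∃ g ∈ G, algebraMap R K g = algebraMap R K a * x := by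
    intro a ha
    obtain ⟨b, hb, hb'⟩ := h a (f1 ha)
    exact ⟨b, ⟨a, ha, by rw [hL, ← hb']; rfl⟩, hb'⟩
  have hG0 : G ≠ ⊥ := by
    intro hbot
    obtain ⟨g, hg, e⟩ := hbG a ha
    rw [hbot, Submodule.mem_bot] at hg
    rw [hg, map_zero] at e
    rcases mul_eq_zero.1 e.symm with h' | h'
    · exact ha0 (IsFractionRing.injective R K (by rw [h', map_zero]))
    · exact hx h'
  have hB : B ≠ ⊥ := fun hB => hG0 (le_bot_iff.1 (hB ▸ hGB))
  refine (mem_tOp hB).2 ⟨G, hG0, hGB, hG, ?_⟩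
  intro y hy
  obtain ⟨r, hr⟩ := f3 (x * y) fun f hf => by
    obtain ⟨g, hg, e⟩ := hbG f hf
    obtain ⟨r, hr⟩ := hy g hg
    exact ⟨r, by rw [hr, e]; ring⟩
  exact ⟨r, by rw [hr, one_mul]⟩

lemma IsMaxTIdeal.one_notMem {M : Ideal R} (hM : IsMaxTIdeal K M) :
    (1 : K) ∉ tOp K (M : FractionalIdeal R⁰ K) := by
  intro h
  exact hM.1 ((Ideal.eq_top_iff_one M).2 (hM.2.1.mem (by rwa [map_one])))

lemma IsMaxTIdeal.one_mem {M : Ideal R} (hM : IsMaxTIdeal K M) {N : Ideal R} (hN : N ≠ ⊥)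
    (h : M < N) : (1 : K) ∈ tOp K (N : FractionalIdeal R⁰ K) := by
  by_contra hc
  have := hM.2.2 (tI K N) (fun ht => hc (by
    have := (Ideal.eq_top_iff_one _).1 ht
    rwa [mem_tI, map_one] at this)) (isTIdeal_tI hN) (h.le.trans (le_tI N))
  exact absurd (le_tI (K := K) N) (this ▸ h.not_ge)

lemma IsMaxTIdeal.isPrime {M : Ideal R} (hM : IsMaxTIdeal K M) : M.IsPrime := by
  refine ⟨hM.1, ?_⟩
  intro a b hab
  by_contra! hc
  obtain ⟨ha, hb⟩ := hc
  have hlt : M < M ⊔ Ideal.span {a} :=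
    lt_of_le_of_ne le_sup_left fun e => ha (e ▸ Ideal.mem_sup_right (Ideal.mem_span_singleton_self a))
  have hN : M ⊔ Ideal.span {a} ≠ ⊥ := fun e => by rw [e] at hlt; exact not_lt_bot hlt
  refine hb (hM.2.1.mem (mem_tOp_of_smul hN (hM.one_mem hN hlt) ?_))
  intro c hc
  refine ⟨c * b, ?_, by rw [map_mul]⟩
  obtain ⟨m, hm, d, hd, rfl⟩ := Submodule.mem_sup.1 hc
  obtain ⟨e, rfl⟩ := Ideal.mem_span_singleton.1 hd
  rw [add_mul]
  refine add_mem (M.mul_mem_right _ hm) ?_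
  rw [mul_right_comm]
  exact M.mul_mem_right _ hab

lemma exists_isMaxTIdeal {N : Ideal R} (hN : N ≠ ⊥)
    (h : (1 : K) ∉ tOp K (N : FractionalIdeal R⁰ K)) : ∃ M, IsMaxTIdeal K M ∧ N ≤ M := by
  obtain ⟨M, hNM, hM⟩ := zorn_le_nonempty₀
    {A : Ideal R | N ≤ A ∧ (1 : K) ∉ tOp K (A : FractionalIdeal R⁰ K)} (by
      intro c hc hch y hy
      refine ⟨sSup c, ⟨(hc hy).1.trans (le_sSup hy), ?_⟩, fun z hz => le_sSup hz⟩
      have h0 : sSup c ≠ ⊥ := fun e => hN (le_bot_iff.1 (e ▸ (hc hy).1.trans (le_sSup hy)))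
      intro h1
      obtain ⟨F, f0, f1, f2, f3⟩ := (mem_tOp h0).1 h1
      obtain ⟨A, hA, hFA⟩ := (Submodule.fg_iff_compact F).1 f2 c (sSup c) ⟨y, hy⟩
        hch.directedOn (isLUB_sSup c) f1
      have hA0 : A ≠ ⊥ := fun e => hN (le_bot_iff.1 (e ▸ (hc hA).1))
      exact (hc hA).2 ((mem_tOp hA0).2 ⟨F, f0, hFA, f2, f3⟩)) N ⟨le_rfl, h⟩
  have hM0 : M ≠ ⊥ := fun e => hN (le_bot_iff.1 (e ▸ hNM))
  have hM1 : (1 : K) ∉ tOp K (M : FractionalIdeal R⁰ K) := hM.prop.2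
  refine ⟨M, ⟨?_, ?_, ?_⟩, hNM⟩
  · intro e
    have : (1 : R) ∈ M := (Ideal.eq_top_iff_one M).1 e
    exact hM1 (by simpa using mem_tOp_self (K := K) this)
  · refine isTIdeal_of hM0 (hM.le_of_ge ⟨hNM.trans (le_tI M), ?_⟩ (le_tI M))
    intro h1
    have ht : tI K M ≠ ⊥ := fun h => hM0 (le_bot_iff.1 (h ▸ le_tI M))
    exact hM1 (tOp_le_of ht hM0 (fun _ hb => hb) h1)
  · intro A hA hAt hMA
    refine le_antisymm hMA (hM.le_of_ge ⟨hNM.trans hMA, fun h1 => ?_⟩ hMA)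
    exact hA ((Ideal.eq_top_iff_one A).2 (hAt.mem (by rwa [map_one])))

lemma IsPvMD.key (hp : IsPvMD (R := R) K) {M : Ideal R} (hM : IsMaxTIdeal K M) {F : Ideal R}
    (hF0 : F ≠ ⊥) (hF : F.FG) :
    ∃ f ∈ F, ∃ h : K, ∃ s : R, s ∉ M ∧ algebraMap R K s = h * algebraMap R K f ∧
      ∀ f ∈ F, ∃ r : R, algebraMap R K r = h * algebraMap R K f := by
  by_contra! hc
  have hle : (F : FractionalIdeal R⁰ K) * (F : FractionalIdeal R⁰ K)⁻¹ ≤ M := by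
    rw [FractionalIdeal.mul_le]
    intro i hi j hj
    obtain ⟨f, hf, rfl⟩ := (FractionalIdeal.mem_coeIdeal _).1 hi
    rw [mem_inv_ideal hF0] at hj
    obtain ⟨s, hs⟩ := hj f hf
    by_cases hsM : s ∈ M
    · rw [mul_comm, ← hs]
      exact FractionalIdeal.mem_coeIdeal_of_mem R⁰ hsM
    · obtain ⟨f', hf', h'⟩ := hc f hf j s hsM hs
      obtain ⟨r, hr⟩ := hj f' hf'
      exact absurd hr (h' r)
  obtain ⟨G, hG⟩ := FractionalIdeal.le_one_iff_exists_coeIdeal.1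
    (hle.trans FractionalIdeal.coeIdeal_le_one)
  have h1 := hp F hF0 hF
  rw [← hG] at h1 hle
  have hGM : G ≤ M := (FractionalIdeal.coeIdeal_le_coeIdeal K).1 hle
  have h11 : (1 : K) ∈ tOp K (G : FractionalIdeal R⁰ K) := by
    rw [h1]; exact Submodule.one_le.1 le_rfl
  have hG0 : G ≠ ⊥ := by
    rintro rfl
    have : (F : FractionalIdeal R⁰ K) * (F : FractionalIdeal R⁰ K)⁻¹ = 0 := by
      rw [← hG]; simp
    obtain ⟨f, hf, hf0⟩ := Submodule.exists_mem_ne_zero_of_ne_bot hF0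
    have hm : algebraMap R K f * 1 ∈
        (F : FractionalIdeal R⁰ K) * (F : FractionalIdeal R⁰ K)⁻¹ :=
      FractionalIdeal.mul_mem_mul (FractionalIdeal.mem_coeIdeal_of_mem R⁰ hf)
        ((mem_inv_ideal hF0).2 fun g _ => ⟨g, by simp⟩)
    rw [this, FractionalIdeal.mem_zero_iff, mul_one] at hm
    exact hf0 (IsFractionRing.injective R K (by rw [hm, map_zero]))
  exact hM.one_notMem (tOp_mono hG0 hGM h11)

lemma mem_locMul {M : Ideal R} (hM : M.IsPrime) {A : Submodule R K} {x : K} :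
    x ∈ locMul K M A ↔ ∃ t : R, t ∉ M ∧ t • x ∈ A := by
  have h0 : ∀ t : R, t ∉ M → algebraMap R K t ≠ 0 := fun t ht h =>
    ht (by rw [IsFractionRing.injective R K (h.trans (map_zero _).symm)]; exact M.zero_mem)
  constructor
  · intro hx
    let S : Submodule R K :=
      { carrier := {x | ∃ t : R, t ∉ M ∧ t • x ∈ A}
        zero_mem' := ⟨1, fun h => hM.ne_top ((Ideal.eq_top_iff_one M).2 h), by simp⟩
        add_mem' := by
          rintro a b ⟨t, ht, ha⟩ ⟨u, hu, hb⟩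
          refine ⟨t * u, fun h => (hM.mem_or_mem h).elim ht hu, ?_⟩
          rw [smul_add]
          refine add_mem ?_ ?_
          · rw [mul_comm, mul_smul]; exact A.smul_mem _ ha
          · rw [mul_smul]; exact A.smul_mem _ hb
        smul_mem' := by
          rintro c a ⟨t, ht, ha⟩
          exact ⟨t, ht, by rw [smul_comm]; exact A.smul_mem _ ha⟩ }
    have : locMul K M A ≤ S := by
      refine iSup_le fun t => iSup_le fun ht => ?_
      rw [Submodule.mul_le]
      intro m hm n hn
      obtain ⟨c, rfl⟩ := Submodule.mem_span_singleton.1 hm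
      refine ⟨t, ht, ?_⟩
      have : t • (c • (algebraMap R K t)⁻¹ * n) = c • n := by
        have := h0 t ht
        rw [Algebra.smul_def, Algebra.smul_def, Algebra.smul_def]
        field_simp
      rw [this]; exact A.smul_mem _ hn
    exact this hx
  · rintro ⟨t, ht, hx⟩
    have : x = (algebraMap R K t)⁻¹ * (t • x) := by
      have := h0 t ht
      rw [Algebra.smul_def]; field_simp
    rw [this]
    exact (le_iSup_of_le (f := fun t => ⨆ (_ : t ∉ M), Submodule.span R {(algebraMap R K t)⁻¹} * A)
      t (le_iSup_of_le ht le_rfl)) (Submodule.mul_mem_mul (Submodule.mem_span_singleton_self _) hx)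

lemma locMul_mul {M : Ideal R} (hM : M.IsPrime) (A B : Submodule R K) :
    locMul K M (A * B) = locMul K M A * locMul K M B := by
  have h0 : ∀ t : R, t ∉ M → algebraMap R K t ≠ 0 := fun t ht h =>
    ht (by rw [IsFractionRing.injective R K (h.trans (map_zero _).symm)]; exact M.zero_mem)
  have hone : (1 : R) ∉ M := fun h => hM.ne_top ((Ideal.eq_top_iff_one M).2 h)
  apply le_antisymm
  · refine iSup_le fun t => iSup_le fun ht => ?_
    rw [← mul_assoc]
    refine mul_le_mul' ?_ ?_
    · exact le_iSup_of_le (f := fun t => ⨆ (_ : t ∉ M),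
        Submodule.span R {(algebraMap R K t)⁻¹} * A) t (le_iSup_of_le ht le_rfl)
    · intro x hx
      exact (mem_locMul hM).2 ⟨1, hone, by rwa [one_smul]⟩
  · rw [Submodule.mul_le]
    intro m hm n hn
    obtain ⟨t, ht, hm⟩ := (mem_locMul hM).1 hm
    obtain ⟨u, hu, hn⟩ := (mem_locMul hM).1 hn
    refine (mem_locMul hM).2 ⟨t * u, fun h => (hM.mem_or_mem h).elim ht hu, ?_⟩
    rw [← smul_mul_smul_comm]
    exact Submodule.mul_mem_mul hm hn

/-- `t`-closure lies in every localization. -/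
lemma IsPvMD.mem_locMul (hp : IsPvMD (R := R) K) {M : Ideal R} (hM : IsMaxTIdeal K M) {B : Ideal R}
    (hB : B ≠ ⊥) {x : K} (hx : x ∈ tOp K (B : FractionalIdeal R⁰ K)) :
    x ∈ locMul K M ((B : FractionalIdeal R⁰ K) : Submodule R K) := by
  obtain ⟨F, f0, f1, f2, f3⟩ := (mem_tOp hB).1 hx
  obtain ⟨f, hf, h, s, hs, e, hh⟩ := hp.key hM f0 f2
  obtain ⟨r, hr⟩ := f3 h hh
  refine (_root_.mem_locMul hM.isPrime).2 ⟨s, hs, ?_⟩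
  have : s • x = algebraMap R K (r * f) := by
    rw [Algebra.smul_def, e, map_mul, hr]; ring
  rw [this]
  exact FractionalIdeal.mem_coeIdeal_of_mem R⁰ (B.mul_mem_left _ (f1 hf))

lemma IsPvMD.locMul_le (hp : IsPvMD (R := R) K) {M : Ideal R} (hM : IsMaxTIdeal K M) {A B : Ideal R}
    (hB : B ≠ ⊥) (h : tOp K (A : FractionalIdeal R⁰ K) ≤ tOp K (B : FractionalIdeal R⁰ K)) :
    locMul K M ((A : FractionalIdeal R⁰ K) : Submodule R K) ≤
      locMul K M ((B : FractionalIdeal R⁰ K) : Submodule R K) := by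
  intro x hx
  obtain ⟨t, ht, hx⟩ := (_root_.mem_locMul hM.isPrime).1 hx
  obtain ⟨a, ha, e⟩ := (FractionalIdeal.mem_coeIdeal _).1 hx
  have := hp.mem_locMul hM hB (h (mem_tOp_self ha))
  obtain ⟨u, hu, hx⟩ := (_root_.mem_locMul hM.isPrime).1 this
  refine (_root_.mem_locMul hM.isPrime).2
    ⟨u * t, fun h => (hM.isPrime.mem_or_mem h).elim hu ht, ?_⟩
  rwa [mul_smul, ← e]

lemma tOp_le_of_locMul {A B : Ideal R} (hA : A ≠ ⊥) (hB : B ≠ ⊥)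
    (h : ∀ M : Ideal R, IsMaxTIdeal K M →
      locMul K M ((A : FractionalIdeal R⁰ K) : Submodule R K) ≤
      locMul K M ((B : FractionalIdeal R⁰ K) : Submodule R K)) :
    tOp K (A : FractionalIdeal R⁰ K) ≤ tOp K (B : FractionalIdeal R⁰ K) := by
  refine tOp_le_of hA hB fun a ha => ?_
  let N : Ideal R := Submodule.comap (LinearMap.toSpanSingleton R R a) B
  have hN : ∀ c, c ∈ N ↔ c * a ∈ B := fun c => Iff.rfl
  have hN0 : N ≠ ⊥ := by
    intro e
    obtain ⟨b, hb, hb0⟩ := Submodule.exists_mem_ne_zero_of_ne_bot hB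
    have : b ∈ N := (hN b).2 (B.mul_mem_right _ hb)
    rw [e] at this
    exact hb0 (by simpa using this)
  refine mem_tOp_of_smul hN0 ?_ fun c hc => ⟨c * a, (hN c).1 hc, by rw [map_mul]⟩
  by_contra h1
  obtain ⟨M, hM, hNM⟩ := exists_isMaxTIdeal hN0 h1
  have ha' : algebraMap R K a ∈ locMul K M ((A : FractionalIdeal R⁰ K) : Submodule R K) :=
    (mem_locMul hM.isPrime).2 ⟨1, fun h => hM.1 ((Ideal.eq_top_iff_one M).2 h), by
      rw [one_smul]; exact FractionalIdeal.mem_coeIdeal_of_mem R⁰ ha⟩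
  obtain ⟨t, ht, hx⟩ := (mem_locMul hM.isPrime).1 (h M hM ha')
  obtain ⟨b, hb, e⟩ := (FractionalIdeal.mem_coeIdeal _).1 hx
  rw [Algebra.smul_def, ← map_mul] at e
  exact ht (hNM ((hN t).2 (IsFractionRing.injective R K e ▸ hb)))

/-- The localization at a maximal `t`-ideal as a valuation subring. -/
lemma IsPvMD.exists_valuationSubring (hp : IsPvMD (R := R) K) {M : Ideal R}
    (hM : IsMaxTIdeal K M) :
    ∃ V : ValuationSubring K, ∀ x, x ∈ V ↔ ∃ s : R, s ∉ M ∧ ∃ r : R,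
      algebraMap R K r = algebraMap R K s * x := by
  have hP := hM.isPrime
  have hone : (1 : R) ∉ M := fun h => hP.ne_top ((Ideal.eq_top_iff_one M).2 h)
  refine ⟨{ carrier := {x | ∃ s : R, s ∉ M ∧ ∃ r : R, algebraMap R K r = algebraMap R K s * x}
            mul_mem' := ?_
            one_mem' := ⟨1, hone, 1, by simp⟩
            add_mem' := ?_
            zero_mem' := ⟨1, hone, 0, by simp⟩
            neg_mem' := ?_
            mem_or_inv_mem' := ?_ }, fun x => Iff.rfl⟩
  · rintro a b ⟨s, hs, r, hr⟩ ⟨s', hs', r', hr'⟩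
    exact ⟨s * s', fun h => (hP.mem_or_mem h).elim hs hs', r * r', by
      rw [map_mul, map_mul, hr, hr']; ring⟩
  · rintro a b ⟨s, hs, r, hr⟩ ⟨s', hs', r', hr'⟩
    exact ⟨s * s', fun h => (hP.mem_or_mem h).elim hs hs', r * s' + r' * s, by
      rw [map_add, map_mul, map_mul, map_mul, hr, hr']; ring⟩
  · rintro a ⟨s, hs, r, hr⟩
    exact ⟨s, hs, -r, by rw [map_neg, hr]; ring⟩
  · intro x
    obtain ⟨a, b, hb, rfl⟩ := IsFractionRing.div_surjective (A := R) x
    have hb0 : b ≠ 0 := nonZeroDivisors.ne_zero hb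
    have hbK : algebraMap R K b ≠ 0 := fun h =>
      hb0 (IsFractionRing.injective R K (by rw [h, map_zero]))
    by_cases ha0 : a = 0
    · left; exact ⟨1, hone, 0, by simp [ha0]⟩
    have haK : algebraMap R K a ≠ 0 := fun h =>
      ha0 (IsFractionRing.injective R K (by rw [h, map_zero]))
    have haF : a ∈ Ideal.span {a, b} := Ideal.subset_span (by simp)
    have hbF : b ∈ Ideal.span {a, b} := Ideal.subset_span (by simp)
    have hF0 : Ideal.span {a, b} ≠ ⊥ := fun e => hb0 (by rw [e] at hbF; simpa using hbF)
    have hF : (Ideal.span {a, b}).FG :=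
      Submodule.fg_span (Set.toFinite _)
    obtain ⟨f, hf, h, s, hs, e, hh⟩ := hp.key hM hF0 hF
    obtain ⟨r, hr⟩ := hh a haF
    obtain ⟨q, hq⟩ := hh b hbF
    obtain ⟨c, d, rfl⟩ := Ideal.mem_span_pair.1 hf
    by_cases hqM : q ∈ M
    · right
      refine ⟨r, fun hrM => hs ?_, q, ?_⟩
      · have : s = c * r + d * q := IsFractionRing.injective R K (by
          rw [e, map_add, map_add, map_mul, map_mul, map_mul, map_mul, hr, hq]; ring)
        rw [this]
        exact add_mem (M.mul_mem_left _ hrM) (M.mul_mem_left _ hqM)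
      · rw [hr, hq]; field_simp
    · left
      refine ⟨q, hqM, r, ?_⟩
      rw [hr, hq]; field_simp

omit [IsDomain R] [IsFractionRing R K] in
lemma mem_of_pow_mem (V : ValuationSubring K) (A : Submodule R K)
    (hA : ∀ a ∈ A, ∀ v ∈ V, v * a ∈ A) {b : K} (n : ℕ) (hb : b ^ (n + 1) ∈ A ^ (n + 1)) :
    b ∈ A := by
  by_contra hbA
  have hlt : ∀ a ∈ A, V.valuation a < V.valuation b := by
    intro a ha
    by_contra! hle
    obtain ⟨v, hv⟩ := (V.valuation_le_iff _ _).1 hle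
    exact hbA (hv ▸ hA a ha v v.2)
  have : ∀ n : ℕ, ∀ x ∈ A ^ (n + 1), V.valuation x < V.valuation b ^ (n + 1) := by
    intro n
    induction n with
    | zero => intro x hx; simpa using hlt x (by simpa using hx)
    | succ n ih =>
      intro x hx
      rw [pow_succ] at hx
      refine Submodule.mul_induction_on hx ?_ ?_
      · intro m hm k hk
        rw [map_mul, pow_succ (V.valuation b)]
        exact mul_lt_mul'' (ih m hm) (hlt k hk) zero_le zero_le
      · intro x y hx hy
        exact V.valuation.map_add_lt hx hy
  have := this n _ hb
  rw [map_pow] at this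
  exact lt_irrefl _ this

end helpers

/-- Let `R` be a PvMD (not a field) and `J ⊆ I` nonzero ideals of `R`.  The following are
equivalent: (1) `J` is a `t`-reduction of `I`; (2) `(J R_M)(I R_M) = (I R_M)²` for each
maximal `t`-ideal `M` of `R`; (3) `(J·I)_t = (I²)_t`. -/
theorem t_reduction_tfae_of_isPvMD
    {R K : Type*} [CommRing R] [IsDomain R] [Field K] [Algebra R K] [IsFractionRing R K]
    (hnf : ¬ IsField R) (hpvmd : IsPvMD (R := R) K)
    (I J : Ideal R) (hI : I ≠ ⊥) (hJ : J ≠ ⊥) (hJI : J ≤ I) :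
    List.TFAE
      [ (∃ n : ℕ, tOp K ((J : FractionalIdeal R⁰ K) * (I : FractionalIdeal R⁰ K) ^ n)
            = tOp K ((I : FractionalIdeal R⁰ K) ^ (n + 1))),
        (∀ M : Ideal R, IsMaxTIdeal K M →
          locMul K M ((J : FractionalIdeal R⁰ K) : Submodule R K)
              * locMul K M ((I : FractionalIdeal R⁰ K) : Submodule R K)
            = locMul K M ((I : FractionalIdeal R⁰ K) : Submodule R K) ^ 2),
        (tOp K ((J : FractionalIdeal R⁰ K) * (I : FractionalIdeal R⁰ K))
            = tOp K ((I : FractionalIdeal R⁰ K) ^ 2)) ] := by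
  have hJI0 : J * I ≠ ⊥ := mul_ne_zero hJ hI
  have hI20 : I ^ 2 ≠ ⊥ := pow_ne_zero 2 hI
  tfae_have 1 → 2 := by
    rintro ⟨n, hn⟩ M hM
    obtain ⟨V, hV⟩ := hpvmd.exists_valuationSubring hM
    have hP := hM.isPrime
    rw [← FractionalIdeal.coeIdeal_pow, ← FractionalIdeal.coeIdeal_pow,
      ← FractionalIdeal.coeIdeal_mul] at hn
    have hloc := le_antisymm
      (hpvmd.locMul_le hM (B := I ^ (n + 1)) (pow_ne_zero _ hI) hn.le)
      (hpvmd.locMul_le hM (B := J * I ^ n) (mul_ne_zero hJ (pow_ne_zero _ hI)) hn.ge)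
    rw [FractionalIdeal.coeIdeal_mul, FractionalIdeal.coeIdeal_pow, FractionalIdeal.coeIdeal_pow,
      FractionalIdeal.coe_mul, FractionalIdeal.coe_pow, FractionalIdeal.coe_pow] at hloc
    set i : Submodule R K := ((I : FractionalIdeal R⁰ K) : Submodule R K)
    set j : Submodule R K := ((J : FractionalIdeal R⁰ K) : Submodule R K)
    have hpow : ∀ k : ℕ, locMul K M (i ^ (k + 1)) = locMul K M i ^ (k + 1) := by
      intro k
      induction k with
      | zero => simp
      | succ k ih => rw [pow_succ, locMul_mul hP, ih, ← pow_succ]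
    have h1 : locMul K M j * locMul K M i ^ (n + 1) = locMul K M i ^ (n + 1) * locMul K M i := by
      calc locMul K M j * locMul K M i ^ (n + 1) = locMul K M (j * i ^ n * i) := by
            rw [← hpow, ← locMul_mul hP, pow_succ, mul_assoc]
        _ = _ := by rw [locMul_mul hP, hloc, hpow]
    have hcl : ∀ a ∈ locMul K M j * locMul K M i, ∀ v ∈ V,
        v * a ∈ locMul K M j * locMul K M i := by
      rw [← locMul_mul hP]
      intro a ha v hv
      obtain ⟨t, ht, ha⟩ := (mem_locMul hP).1 ha
      obtain ⟨s, hs, r, hr⟩ := (hV v).1 hv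
      refine (mem_locMul hP).2 ⟨s * t, fun h => (hP.mem_or_mem h).elim hs ht, ?_⟩
      have : (s * t) • (v * a) = r • (t • a) := by
        rw [Algebra.smul_def, Algebra.smul_def, Algebra.smul_def, hr, map_mul]; ring
      rw [this]
      exact Submodule.smul_mem _ _ ha
    have hle : locMul K M j ≤ locMul K M i := by
      intro x hx
      obtain ⟨t, ht, hx⟩ := (mem_locMul hP).1 hx
      exact (mem_locMul hP).2 ⟨t, ht, (FractionalIdeal.coeIdeal_le_coeIdeal K).2 hJI hx⟩
    generalize locMul K M i = Im at *
    generalize locMul K M j = Jm at *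
    have h2 : ∀ k : ℕ, Jm ^ k * Im ^ (n + 1) = Im ^ (n + 1) * Im ^ k := by
      intro k
      induction k with
      | zero => simp
      | succ k ih =>
        rw [pow_succ' Jm, mul_assoc, ih, ← mul_assoc, h1, mul_assoc, ← pow_succ' Im]
    apply le_antisymm
    · rw [pow_two]; exact mul_le_mul' hle le_rfl
    · intro b hb
      refine mem_of_pow_mem V _ hcl n ?_
      rw [mul_pow, h2, ← mul_pow, ← pow_two]
      exact Submodule.pow_mem_pow _ hb _
  tfae_have 2 → 3 := by
    intro h
    rw [← FractionalIdeal.coeIdeal_pow, ← FractionalIdeal.coeIdeal_mul]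
    have key : ∀ M : Ideal R, IsMaxTIdeal K M →
        locMul K M (((J * I : Ideal R) : FractionalIdeal R⁰ K) : Submodule R K) =
        locMul K M (((I ^ 2 : Ideal R) : FractionalIdeal R⁰ K) : Submodule R K) := by
      intro M hM
      rw [pow_two, FractionalIdeal.coeIdeal_mul, FractionalIdeal.coeIdeal_mul,
        FractionalIdeal.coe_mul, FractionalIdeal.coe_mul, locMul_mul hM.isPrime,
        locMul_mul hM.isPrime, h M hM, pow_two]
    exact le_antisymm (tOp_le_of_locMul hJI0 hI20 fun M hM => (key M hM).le)
      (tOp_le_of_locMul hI20 hJI0 fun M hM => (key M hM).ge)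
  tfae_have 3 → 1 := fun h => ⟨1, by simpa using h⟩
  tfae_finish
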